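/- Let a be an irrational positive real number, let Ω = Ω(L, h) = ∪_{|l|≤L} [l − h/2, l + h/2] be a Landau set (L a positive integer, 0 < h < 1), let χ be a continuous function on Ω, and let λ_0 ∈ ℝ and ε > 0 be given. Then there exist a positive integer K, real numbers λ_1 < λ_2 < … < λ_K, and complex numbers c_1, …, c_K, such that the trigonometric polynomial P(t) = Σ_{n=1}^K c_n e^{2πiλ_n t} satisfies: (1) |P(t) − χ(t)| ≤ ε for all t ∈ Ω; (2) λ_{n+1} − λ_n ∈ {1, a} for every n = 0, 1, …, K − 1. -/

import Mathlib

/-- The character `x ↦ e^{2πix}`. -/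
noncomputable def ee (x : ℝ) : ℂ := Complex.exp (2 * Real.pi * Complex.I * x)

lemma ee_add (x y : ℝ) : ee (x + y) = ee x * ee y := by
  unfold ee; rw [← Complex.exp_add]; congr 1; push_cast; ring

lemma ee_zero : ee 0 = 1 := by simp [ee]

lemma ee_norm (x : ℝ) : ‖ee x‖ = 1 := by
  unfold ee
  rw [show (2 * Real.pi * Complex.I * x : ℂ) = ((2 * Real.pi * x : ℝ) : ℂ) * Complex.I by
    push_cast; ring]
  exact Complex.norm_exp_ofReal_mul_I _

lemma ee_int (n : ℤ) : ee n = 1 := by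
  unfold ee
  rw [Complex.exp_eq_one_iff]
  exact ⟨n, by push_cast; ring⟩

lemma ee_nat_mul (n : ℕ) (x : ℝ) : ee (n * x) = ee x ^ n := by
  unfold ee; rw [← Complex.exp_nat_mul]; congr 1; push_cast; ring

lemma ee_ne (x : ℝ) : ee x ≠ 0 := Complex.exp_ne_zero _

lemma ee_neg (x : ℝ) : ee (-x) = (ee x)⁻¹ := by
  unfold ee; rw [← Complex.exp_neg]; congr 1; push_cast; ring

lemma ee_cont : Continuous ee := by unfold ee; fun_prop

lemma ee_inj (x y : ℝ) (hxy : ee x = ee y) : ∃ n : ℤ, x - y = n := by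
  unfold ee at hxy
  rw [Complex.exp_eq_exp_iff_exists_int] at hxy
  obtain ⟨n, hn⟩ := hxy
  refine ⟨n, ?_⟩
  have h2 : (2 * Real.pi * Complex.I : ℂ) ≠ 0 := Complex.two_pi_I_ne_zero
  have : (2 * Real.pi * Complex.I : ℂ) * (x - y - n) = 0 := by linear_combination hn
  have h3 := (mul_eq_zero.mp this).resolve_left h2
  have h4 : ((x - y - n : ℝ) : ℂ) = 0 := by push_cast; exact h3
  have h5 := Complex.ofReal_eq_zero.mp h4
  linarith

lemma sum_Icc_shift (f : ℕ → ℂ) (K : ℕ) :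
    ∑ n ∈ Finset.Icc 1 K, f n = ∑ k ∈ Finset.range K, f (k + 1) := by
  induction K with
  | zero => simp
  | succ K ih => rw [Finset.sum_Icc_succ_top (by omega), ih, Finset.sum_range_succ]

/-- Exponential sums with admissible frequencies starting (exclusively) from `lam`. -/
inductive Reach (a : ℝ) : ℝ → (ℝ → ℂ) → Prop
  | nil (lam : ℝ) : Reach a lam (fun _ => 0)
  | step (lam d : ℝ) (hd : d = 1 ∨ d = a) (c : ℂ) (F : ℝ → ℂ) (hF : Reach a (lam + d) F) :
      Reach a lam (fun t => c * ee ((lam + d) * t) + F t)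

lemma Reach.exists_seq {a : ℝ} (ha : 0 < a) {lam₀ : ℝ} {F : ℝ → ℂ} (hF : Reach a lam₀ F) :
    ∃ (K : ℕ) (lam : ℕ → ℝ) (c : ℕ → ℂ),
      0 < K ∧ lam 0 = lam₀ ∧
      (∀ n : ℕ, n < K → lam n < lam (n + 1)) ∧
      (∀ n : ℕ, n < K → lam (n + 1) - lam n ∈ ({1, a} : Set ℝ)) ∧
      ∀ t, F t = ∑ n ∈ Finset.Icc 1 K, c n * ee (lam n * t) := by
  induction hF with
  | nil lam =>
    refine ⟨1, fun n => lam + n, fun _ => 0, one_pos, by simp, ?_, ?_, by simp⟩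
    · intro n _; push_cast; linarith
    · intro n _; left; push_cast; ring
  | step lam d hd c F hF ih =>
    obtain ⟨K, l, c', hK, h0, h1, h2, h3⟩ := ih
    have hdpos : 0 < d := by rcases hd with rfl | rfl <;> simp [ha]
    refine ⟨K + 1, fun n => Nat.casesOn n lam l,
      fun n => Nat.casesOn n 0 (fun k => Nat.casesOn k c (fun j => c' (j+1))),
      by omega, rfl, ?_, ?_, ?_⟩
    · rintro (_ | n) hn
      · change lam < l 0
        rw [h0]; linarith
      · exact h1 n (by omega)
    · rintro (_ | n) hn
      · change l 0 - lam ∈ _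
        rw [h0]; rcases hd with rfl | rfl <;> simp
      · exact h2 n (by omega)
    · intro t
      rw [sum_Icc_shift, Finset.sum_range_succ']
      change c * ee ((lam + d) * t) + F t =
        ∑ k ∈ Finset.range K, c' (k + 1) * ee (l (k + 1) * t) + c * ee (l 0 * t)
      rw [h3 t, sum_Icc_shift, h0, add_comm]

lemma Reach.run {a : ℝ} (N : ℕ) : ∀ (lam : ℝ) (c : ℕ → ℂ) (F : ℝ → ℂ)
    (hF : Reach a (lam + N) F),
    Reach a lam (fun t => ∑ n ∈ Finset.range N, c n * ee ((lam + n + 1) * t) + F t) := by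
  induction N with
  | zero => intro lam c F hF; simpa using hF
  | succ N ih =>
    intro lam c F hF
    have := ih (lam + 1) (fun n => c (n + 1)) F (by
      convert hF using 1; push_cast; ring)
    convert Reach.step lam 1 (Or.inl rfl) (c 0) _ this using 2 with t
    rw [Finset.sum_range_succ']
    simp only [Nat.cast_zero, add_zero, Nat.cast_add, Nat.cast_one]
    have : ∀ n : ℕ, lam + 1 + (n : ℝ) + 1 = lam + (n + 1) + 1 := by intro n; ring
    simp only [this]
    ring

lemma density {h : ℝ} (hh0 : 0 < h) (hh1 : h < 1) (f : ℝ → ℂ)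
    (hf : ContinuousOn f (Set.Icc (-(h/2)) (h/2))) (ε : ℝ) (hε : 0 < ε) :
    ∃ p : Polynomial ℂ, ∀ s ∈ Set.Icc (-(h/2)) (h/2), ‖p.eval (ee s) - f s‖ < ε := by
  let I := Set.Icc (-(h/2)) (h/2)
  let z : C(I, ℂ) := ⟨fun s => ee s, ee_cont.comp continuous_subtype_val⟩
  have hzinj : Function.Injective z := by
    intro x y hxy
    obtain ⟨n, hn⟩ := ee_inj _ _ hxy
    have hx := x.2
    have hy := y.2
    simp only [I, Set.mem_Icc] at hx hy
    have h1 : (n : ℝ) < 1 := by linarith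
    have h2 : (-1 : ℝ) < n := by linarith
    have h3 : n < 1 := by exact_mod_cast h1
    have h4 : -1 < n := by exact_mod_cast h2
    have : n = 0 := by omega
    subst this
    apply Subtype.ext
    simp at hn; linarith
  let S : Subalgebra ℂ C(I, ℂ) := (Algebra.adjoin ℂ {z}).topologicalClosure
  have hzS : z ∈ S := Subalgebra.le_topologicalClosure _ (Algebra.self_mem_adjoin_singleton ℂ z)
  have hSc : IsClosed (S : Set C(I, ℂ)) := Subalgebra.isClosed_topologicalClosure _
  have hspec : ∀ r : ℝ, r ≤ 0 → (r : ℂ) ∉ spectrum ℂ z := by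
    intro r hr hmem
    rw [ContinuousMap.spectrum_eq_range] at hmem
    obtain ⟨s, hs⟩ := hmem
    have hs2 := s.2
    simp only [I, Set.mem_Icc] at hs2
    have hs' : ee s = r := hs
    have hn : |r| = 1 := by
      have := ee_norm s
      rw [hs', Complex.norm_real] at this; exact this
    have hr1 : r = -1 := by rw [abs_of_nonpos hr] at hn; linarith
    have hhalf : ee (1/2) = -1 := by
      unfold ee
      rw [← Complex.exp_pi_mul_I]; congr 1; push_cast; ring
    obtain ⟨n, hn⟩ := ee_inj s (1/2) (by rw [hs', hhalf, hr1]; simp)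
    have h1 : (n : ℝ) < 0 := by linarith
    have h2 : (-1 : ℝ) < n := by linarith
    have h3 : n < 0 := by exact_mod_cast h1
    have h4 : -1 < n := by exact_mod_cast h2
    omega
  have hunit : (0 : ℂ) ∉ spectrum ℂ (⟨z, hzS⟩ : S) := by
    intro h0
    have hb := Subalgebra.spectrum_isBounded_connectedComponentIn S (hS := hSc) (⟨z, hzS⟩ : S) h0
    have hsub : (fun r : ℝ => (r : ℂ)) '' Set.Iic 0 ⊆
        connectedComponentIn (spectrum ℂ z)ᶜ 0 := by
      apply IsPreconnected.subset_connectedComponentIn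
      · exact isPreconnected_Iic.image _ Complex.continuous_ofReal.continuousOn
      · exact ⟨0, by simp, by simp⟩
      · rintro _ ⟨r, hr, rfl⟩
        exact hspec r hr
    have hb2 := hb.subset hsub
    obtain ⟨C, hC⟩ := hb2.exists_norm_le
    have := hC _ ⟨-(|C| + 1), by
      have := abs_nonneg C
      simp only [Set.mem_Iic]; linarith, rfl⟩
    simp only [Complex.norm_real, norm_neg, Real.norm_eq_abs] at this
    rw [abs_of_pos (by positivity)] at this
    linarith [le_abs_self C]
  have hstar : star z ∈ S := by
    rw [spectrum.zero_notMem_iff] at hunit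
    obtain ⟨w, hw⟩ := hunit.exists_right_inv
    have hw' : z * (w : C(I, ℂ)) = 1 := congrArg Subtype.val hw
    have : star z = w := by
      ext s
      have h1 : z s * (w : C(I, ℂ)) s = 1 := congrFun (congrArg DFunLike.coe hw') s
      have h2 : star (z s) * z s = 1 := by
        have := ee_norm s
        have h3 := Complex.conj_mul' (z s)
        have h4 : ‖z s‖ = 1 := ee_norm s
        rw [h4] at h3
        simpa using h3
      calc star (z s) = star (z s) * (z s * (w : C(I, ℂ)) s) := by rw [h1, mul_one]
        _ = _ := by rw [← mul_assoc, h2, one_mul]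
    rw [this]; exact w.2
  have hSW := ContinuousMap.starSubalgebra_topologicalClosure_eq_top_of_separatesPoints
    (StarAlgebra.adjoin ℂ {z}) (by
      intro x y hxy
      exact ⟨z, ⟨z, StarAlgebra.self_mem_adjoin_singleton ℂ z, rfl⟩, fun h => hxy (hzinj h)⟩)
  have hle : ((StarAlgebra.adjoin ℂ {z} : StarSubalgebra ℂ C(I, ℂ)) : Set C(I, ℂ)) ⊆ S := by
    have : (StarAlgebra.adjoin ℂ {z}).toSubalgebra ≤ S := by
      rw [StarAlgebra.adjoin_toSubalgebra]
      apply Algebra.adjoin_le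
      rintro x (hx | hx)
      · rw [Set.mem_singleton_iff.mp hx]; exact hzS
      · have : x = star z := by
          rw [Set.mem_star, Set.mem_singleton_iff] at hx; rw [← hx, star_star]
        rw [this]; exact hstar
    exact this
  let g : C(I, ℂ) := ⟨I.domRestrict f, hf.domRestrict⟩
  have hg : g ∈ closure ((Algebra.adjoin ℂ {z} : Subalgebra ℂ C(I, ℂ)) : Set C(I, ℂ)) := by
    have h1 : g ∈ (StarAlgebra.adjoin ℂ {z} : StarSubalgebra ℂ C(I, ℂ)).topologicalClosure := by
      rw [hSW]; trivial
    have h2 := closure_minimal hle hSc h1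
    exact h2
  obtain ⟨q, hq, hd⟩ := Metric.mem_closure_iff.mp hg ε hε
  rw [SetLike.mem_coe, Algebra.adjoin_singleton_eq_range_aeval] at hq
  obtain ⟨p, rfl⟩ := hq
  refine ⟨p, fun s hs => ?_⟩
  have h1 := (ContinuousMap.dist_apply_le_dist (f := g) (g := Polynomial.aeval z p) ⟨s, hs⟩).trans_lt hd
  rw [dist_comm, dist_eq_norm] at h1
  have h2 : (Polynomial.aeval z p) ⟨s, hs⟩ = p.eval (ee s) := by
    simp [z]
  rw [h2] at h1
  exact h1

lemma blocks {a h : ℝ} (hh0 : 0 < h) (hh1 : h < 1) (m : ℕ) :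
    ∀ (f : ℕ → ℝ → ℂ) (hf : ∀ k, ContinuousOn (f k) (Set.Icc (-(h/2)) (h/2)))
      (lam ε : ℝ) (hε : 0 < ε),
    ∃ F, Reach a lam F ∧ ∀ l : ℤ, ∀ s ∈ Set.Icc (-(h/2)) (h/2),
      ‖F (l + s) - ∑ k ∈ Finset.range m, ee ((lam + (k + 1) * a) * (l + s)) * f k s‖ ≤ ε := by
  induction m with
  | zero => intro f hf lam ε hε; exact ⟨_, Reach.nil lam, by simp [hε.le]⟩
  | succ m ih =>
    intro f hf lam ε hε
    obtain ⟨p, hp⟩ := density hh0 hh1 (f 0) (hf 0) (ε/2) (by positivity)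
    set N := p.natDegree with hN
    obtain ⟨F, hF, hFa⟩ := ih (fun k s => ee (-(N * s)) * f (k+1) s)
      (fun k => ContinuousOn.mul (Continuous.continuousOn
        (ee_cont.comp (by fun_prop))) (hf (k+1)))
      (lam + a + N) (ε/2) (by positivity)
    refine ⟨_, Reach.step lam a (Or.inr rfl) (p.coeff 0) _
      (Reach.run N (lam + a) (fun n => p.coeff (n+1)) F hF), ?_⟩
    intro l s hs
    have hN1 : ∀ n : ℕ, ee (n * (l + s)) = ee s ^ n := by
      intro n
      rw [ee_nat_mul, ee_add, ee_int, one_mul]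
    have key : p.coeff 0 * ee ((lam + a) * (l + s)) + 
        ∑ n ∈ Finset.range N, p.coeff (n+1) * ee ((lam + a + n + 1) * (l + s)) =
        ee ((lam + a) * (l + s)) * p.eval (ee s) := by
      rw [Polynomial.eval_eq_sum_range, ← hN, Finset.sum_range_succ',
        mul_add (ee _), Finset.mul_sum, add_comm]
      congr 1
      · refine Finset.sum_congr rfl fun n _ => ?_
        rw [← hN1 (n+1), mul_left_comm, ← ee_add]
        congr 2; push_cast; ring
      · simp; ring
    have key2 : ∀ k : ℕ, ee ((lam + a + N + (k + 1) * a) * (l + s)) *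
        (ee (-(N * s)) * f (k+1) s) = ee ((lam + ((k + 1 : ℕ) + 1) * a) * (l + s)) * f (k+1) s := by
      intro k
      have : (lam + a + N + (k + 1) * a) * (l + s) =
        (lam + ((k + 1 : ℕ) + 1) * a) * (l + s) + N * (l + s) := by push_cast; ring
      rw [this, ee_add, hN1, ee_neg, ee_nat_mul]
      have := pow_ne_zero N (ee_ne s)
      field_simp
    have h1 := hFa l s hs
    simp only [key2] at h1
    rw [Finset.sum_range_succ', ← add_assoc, key]
    have h2 : ‖ee ((lam + a) * (l + s)) * (p.eval (ee s) - f 0 s)‖ ≤ ε / 2 := by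
      rw [norm_mul, ee_norm, one_mul]; exact (hp s hs).le
    have h3 := (norm_add_le _ _).trans (add_le_add h2 h1)
    rw [add_halves] at h3
    refine le_trans (le_of_eq ?_) h3
    congr 1
    simp only [Nat.cast_zero, zero_add, one_mul]
    ring

theorem trig_approx_two_gap_frequencies
    (a : ℝ) (ha : 0 < a) (hairr : Irrational a)
    (L : ℕ) (hL : 0 < L) (h : ℝ) (hh0 : 0 < h) (hh1 : h < 1)
    (Ω : Set ℝ)
    (hΩ : Ω = ⋃ l ∈ Finset.Icc (-(L : ℤ)) (L : ℤ),
      Set.Icc ((l : ℝ) - h / 2) ((l : ℝ) + h / 2))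
    (χ : ℝ → ℂ) (hχ : ContinuousOn χ Ω)
    (lam₀ : ℝ) (ε : ℝ) (hε : 0 < ε) :
    ∃ (K : ℕ) (lam : ℕ → ℝ) (c : ℕ → ℂ),
      0 < K ∧
      lam 0 = lam₀ ∧
      (∀ n : ℕ, n < K → lam n < lam (n + 1)) ∧
      (∀ n : ℕ, n < K → lam (n + 1) - lam n ∈ ({1, a} : Set ℝ)) ∧
      (∀ t ∈ Ω,
        ‖(∑ n ∈ Finset.Icc 1 K,
            c n * Complex.exp (2 * Real.pi * Complex.I * lam n * t)) - χ t‖ ≤ ε) := by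
  let m := 2 * L + 1
  let ν : Fin m → ℤ := fun i => (i : ℤ) - L
  let v : Fin m → ℂ := fun i => ee (a * ν i)
  have hv : Function.Injective v := by
    intro i j hij
    obtain ⟨n, hn⟩ := ee_inj _ _ hij
    by_contra hne
    have hd : ν i - ν j ≠ 0 := by
      intro h0
      apply hne
      apply Fin.ext
      simp only [ν] at h0
      omega
    apply hairr
    refine ⟨(n : ℚ) / ((ν i - ν j : ℤ) : ℚ), ?_⟩
    have hd' : ((ν i - ν j : ℤ) : ℝ) ≠ 0 := by exact_mod_cast hd
    push_cast at hd' ⊢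
    rw [div_eq_iff hd']
    linarith
  have hdet : IsUnit (Matrix.vandermonde v).det :=
    (Matrix.det_vandermonde_ne_zero_iff.mpr hv).isUnit
  have hW := Matrix.mul_nonsing_inv _ hdet
  set W := (Matrix.vandermonde v)⁻¹ with hWd
  have hmem : ∀ i : Fin m, ∀ s ∈ Set.Icc (-(h/2)) (h/2), (ν i : ℝ) + s ∈ Ω := by
    intro i s hs
    rw [hΩ]
    simp only [Set.mem_iUnion]
    refine ⟨ν i, ?_, ?_⟩
    · have := i.2
      simp only [Finset.mem_Icc, ν]; omega
    · constructor <;> linarith [hs.1, hs.2]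
  let f : ℕ → ℝ → ℂ := fun k s => if hk : k < m then
    ee (-((lam₀ + (k + 1) * a) * s)) *
      ∑ i, W ⟨k, hk⟩ i * (ee (-((lam₀ + a) * ν i)) * χ (ν i + s)) else 0
  have hf : ∀ k, ContinuousOn (f k) (Set.Icc (-(h/2)) (h/2)) := by
    intro k
    by_cases hk : k < m
    · simp only [f, hk, dif_pos]
      refine ContinuousOn.mul (ee_cont.comp (by fun_prop)).continuousOn ?_
      refine continuousOn_finsetSum _ fun i _ => ?_
      refine continuousOn_const.mul (continuousOn_const.mul ?_)
      exact hχ.comp (by fun_prop) (fun s hs => hmem i s hs)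
    · simp only [f, hk, dif_neg, not_false_eq_true]
      exact continuousOn_const
  obtain ⟨F, hF, hFa⟩ := blocks (a := a) hh0 hh1 m f hf lam₀ ε hε
  obtain ⟨K, lam, c, h1, h2, h3, h4, h5⟩ := hF.exists_seq ha
  refine ⟨K, lam, c, h1, h2, h3, h4, ?_⟩
  intro t ht
  have e1 : (∑ n ∈ Finset.Icc 1 K,
            c n * Complex.exp (2 * Real.pi * Complex.I * lam n * t)) = F t := by
    rw [h5]
    refine Finset.sum_congr rfl fun n _ => ?_
    unfold ee
    congr 2; push_cast; ring
  rw [e1]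
  obtain ⟨j, s, hs, rfl⟩ : ∃ j : Fin m, ∃ s ∈ Set.Icc (-(h/2)) (h/2), t = ν j + s := by
    rw [hΩ] at ht
    simp only [Set.mem_iUnion] at ht
    obtain ⟨l, hl, hlt⟩ := ht
    rw [Finset.mem_Icc] at hl
    have hl1 : ν ⟨(l + L).toNat, by omega⟩ = l := by
      simp only [ν]; omega
    refine ⟨⟨(l + L).toNat, by omega⟩, t - l, ?_, ?_⟩
    · constructor <;> linarith [hlt.1, hlt.2]
    · rw [hl1]; ring
  have h6 := hFa (ν j) s hs
  convert h6 using 3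
  rw [← Fin.sum_univ_eq_sum_range (fun k => ee ((lam₀ + (k + 1) * a) * (ν j + s)) * f k s) m]
  have e2 : ∀ k : Fin m, ee ((lam₀ + ((k : ℕ) + 1) * a) * (ν j + s)) * f k s =
      ∑ i, ee ((lam₀ + a) * ν j) * (Matrix.vandermonde v j k * W k i) *
        (ee (-((lam₀ + a) * ν i)) * χ (ν i + s)) := by
    intro k
    simp only [f, k.2, dif_pos, Fin.eta]
    rw [← mul_assoc, ← ee_add, Finset.mul_sum]
    refine Finset.sum_congr rfl fun i _ => ?_
    rw [Matrix.vandermonde_apply]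
    simp only [v]
    rw [← ee_nat_mul]
    have : (lam₀ + ((k : ℕ) + 1) * a) * (ν j + s) + -((lam₀ + ((k : ℕ) + 1) * a) * s) =
      (lam₀ + a) * ν j + (k : ℕ) * (a * ν j) := by ring
    rw [this, ee_add]
    ring
  simp only [e2]
  rw [Finset.sum_comm]
  simp only [← Finset.sum_mul, ← Finset.mul_sum, ← Matrix.mul_apply, hW]
  rw [Finset.sum_eq_single j]
  · rw [Matrix.one_apply_eq, mul_one, ← mul_assoc, ← ee_add, add_neg_cancel, ee_zero, one_mul]
  · intro i _ hi
    rw [Matrix.one_apply_ne hi.symm]; simp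
  · simp
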